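/- arXiv:2210.10279 — 2 statements merged into one kernel-verified Lean document; each statement's English description precedes it below -/
import Mathlib

section
/- Let ℓ be a prime number, R a commutative ring in which ℓ·1=0, B an associative R-algebra, and σ an R-algebra automorphism of B with σ^{ℓ^m}=id_B for some m≥0. For x∈B let O(x)=Σ_{0≤i<k}σ^i(x), where k≥1 is minimal with σ^k(x)=x. Then the R-submodule 𝕁 of B spanned by {O(x) : x∈B, σ(x)≠x} is a two-sided ideal of the fixed-point subalgebra B^σ={b∈B : σ(b)=b}. -/
theorem RingEquiv.pow_apply_eq_iterate {B : Type*} [Mul B] [Add B] (σ : B ≃+* B) (n : ℕ) (x : B) :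
    (σ ^ n) x = σ^[n] x := by
  induction n generalizing x with
  | zero => rfl
  | succ n ih => rw [pow_succ, RingAut.mul_apply, ih, Function.iterate_succ_apply]

/-- A sum over `q` periods of an iteration is `q` times the sum over one period. -/
theorem Function.IsPeriodicPt.sum_range_mul_iterate {B : Type*} [AddCommMonoid B] {f : B → B}
    {p : ℕ} {y : B} (hy : Function.IsPeriodicPt f p y) (q : ℕ) :
    ∑ i ∈ Finset.range (p * q), f^[i] y = q • ∑ i ∈ Finset.range p, f^[i] y := by
  induction q with
  | zero => simp
  | succ q ih =>
    rw [Nat.mul_succ, Finset.sum_range_add, ih, succ_nsmul]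
    congr 1
    refine Finset.sum_congr rfl fun i _ => ?_
    rw [add_comm, Function.iterate_add_apply, (hy.mul_const q).eq]

/-- The image of the sum over one period under the iterated map is the same sum. -/
theorem Function.IsPeriodicPt.map_sum_range_iterate {B F : Type*} [AddCommGroup B]
    [FunLike F B B] [AddMonoidHomClass F B B] {f : F}
    {p : ℕ} {y : B} (hy : Function.IsPeriodicPt f p y) :
    f (∑ i ∈ Finset.range p, f^[i] y) = ∑ i ∈ Finset.range p, f^[i] y := by
  simp only [map_sum, ← Function.iterate_succ_apply']
  apply add_right_cancel (b := f^[0] y)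
  rw [← Finset.sum_range_succ' (fun i => f^[i] y), Finset.sum_range_succ, hy.eq, Function.iterate_zero_apply]

/-- In characteristic `ℓ`, a sum over a (not necessarily minimal) period divisible by `ℓ` is a
multiple of the orbit sum of a non-fixed element, or vanishes. -/
theorem Function.IsPeriodicPt.sum_range_iterate_mem {R B : Type*} [Ring R] [AddCommGroup B]
    [Module R B] {ℓ : ℕ} (hchar : (ℓ : R) = 0) {f : B → B} {J : Submodule R B}
    (hJ : ∀ x, f x ≠ x → 0 < Function.minimalPeriod f x →
      ∑ i ∈ Finset.range (Function.minimalPeriod f x), f^[i] x ∈ J)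
    {k : ℕ} (hk : 0 < k) (hℓk : ℓ ∣ k) {y : B} (hy : Function.IsPeriodicPt f k y) :
    ∑ i ∈ Finset.range k, f^[i] y ∈ J := by
  by_cases hfix : f y = y
  · obtain ⟨c, rfl⟩ := hℓk
    have hsum : ∑ i ∈ Finset.range (ℓ * c), f^[i] y = 0 := by
      simp only [Function.iterate_fixed hfix, Finset.sum_const, Finset.card_range]
      rw [← Nat.cast_smul_eq_nsmul R, Nat.cast_mul, hchar, zero_mul, zero_smul]
    exact hsum ▸ J.zero_mem
  · obtain ⟨q, hq⟩ := hy.minimalPeriod_dvd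
    rw [hq, (Function.isPeriodicPt_minimalPeriod f y).sum_range_mul_iterate]
    exact J.smul_of_tower_mem q (hJ y hfix (hy.minimalPeriod_pos hk))

/-!
STATEMENT 5: Let ℓ be a prime number, `R` a commutative ring in which `ℓ·1 = 0`,
`B` an associative `R`-algebra, and `σ` an `R`-algebra automorphism of `B` with
`σ^(ℓ^m) = id` for some `m ≥ 0`.  For `x ∈ B` let `O(x) = Σ_{0 ≤ i < k} σ^i(x)`
where `k ≥ 1` is minimal with `σ^k(x) = x`.  Then the `R`-submodule `𝕁` of `B`
spanned by `{O(x) : σ(x) ≠ x}` is a two-sided ideal of the fixed-point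
subalgebra `B^σ = {b : σ(b) = b}`.
-/
theorem orbit_sum_span_is_two_sided_ideal_of_fixed_subalgebra
    (ℓ : ℕ) (hℓ : ℓ.Prime)
    (R : Type*) [CommRing R] (hchar : (ℓ : R) = 0)
    (B : Type*) [NonUnitalRing B] [Module R B]
    [SMulCommClass R B B] [IsScalarTower R B B]
    (σ : B ≃+* B) (hσlin : ∀ (r : R) (x : B), σ (r • x) = r • σ x)
    (m : ℕ) (hσord : σ ^ (ℓ ^ m) = 1)
    (J : Submodule R B)
    (hJ : J = Submodule.span R {y : B | ∃ (x : B) (k : ℕ), 0 < k ∧ (σ ^ k) x = x ∧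
        (∀ k', 0 < k' → (σ ^ k') x = x → k ≤ k') ∧ σ x ≠ x ∧
        y = ∑ i ∈ Finset.range k, (σ ^ i) x}) :
    (∀ a ∈ J, σ a = a) ∧
    (∀ b : B, σ b = b → ∀ a ∈ J, b * a ∈ J ∧ a * b ∈ J) := by
  simp only [RingEquiv.pow_apply_eq_iterate] at hJ
  have orbit_mem : ∀ x, σ x ≠ x → 0 < Function.minimalPeriod σ x →
      ∑ i ∈ Finset.range (Function.minimalPeriod σ x), σ^[i] x ∈ J := by
    intro x hx hpos
    rw [hJ]
    exact Submodule.subset_span ⟨x, _, hpos, Function.iterate_minimalPeriod,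
      fun k' hk' h => Function.IsPeriodicPt.minimalPeriod_le hk' h, hx, rfl⟩
  have dvd_period : ∀ (x : B) (k : ℕ), 0 < k → σ^[k] x = x →
      (∀ k', 0 < k' → σ^[k'] x = x → k ≤ k') → σ x ≠ x → ℓ ∣ k := by
    intro x k hk hkx hmin hx
    have hk_eq : k = Function.minimalPeriod σ x :=
      le_antisymm (hmin _ (Function.IsPeriodicPt.minimalPeriod_pos hk hkx)
        Function.iterate_minimalPeriod) (Function.IsPeriodicPt.minimalPeriod_le hk hkx)
    have hper : Function.IsPeriodicPt σ (ℓ ^ m) x := by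
      rw [Function.IsPeriodicPt, Function.IsFixedPt, ← RingEquiv.pow_apply_eq_iterate, hσord]
      rfl
    obtain ⟨j, -, hj⟩ := (Nat.dvd_prime_pow hℓ).1 (hk_eq ▸ hper.minimalPeriod_dvd)
    rw [hj]
    refine dvd_pow_self ℓ fun hj0 => hx ?_
    simpa [hj, hj0] using hkx
  refine ⟨fun a ha => ?_, fun b hb a ha => ?_⟩
  · rw [hJ] at ha
    induction ha using Submodule.span_induction with
    | mem y hy =>
      obtain ⟨x, k, -, hkx, -, -, rfl⟩ := hy
      exact Function.IsPeriodicPt.map_sum_range_iterate hkx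
    | zero => exact map_zero σ
    | add y z _ _ hy hz => rw [map_add, hy, hz]
    | smul r y _ hy => rw [hσlin, hy]
  · have iterate_b (i : ℕ) : σ^[i] b = b := Function.iterate_fixed hb i
    have iterate_mul (i : ℕ) (x y : B) : σ^[i] (x * y) = σ^[i] x * σ^[i] y := by
      simp only [← RingEquiv.pow_apply_eq_iterate, map_mul]
    rw [hJ] at ha
    induction ha using Submodule.span_induction with
    | mem y hy =>
      obtain ⟨x, k, hk, hkx, hmin, hx, rfl⟩ := hy
      have hℓk := dvd_period x k hk hkx hmin hx
      have hbx : Function.IsPeriodicPt σ k (b * x) := by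
        rw [Function.IsPeriodicPt, Function.IsFixedPt, iterate_mul, iterate_b, hkx]
      have hxb : Function.IsPeriodicPt σ k (x * b) := by
        rw [Function.IsPeriodicPt, Function.IsFixedPt, iterate_mul, iterate_b, hkx]
      have hleft := hbx.sum_range_iterate_mem hchar orbit_mem hk hℓk
      have hright := hxb.sum_range_iterate_mem hchar orbit_mem hk hℓk
      simp only [iterate_mul, iterate_b] at hleft hright
      rw [Finset.mul_sum, Finset.sum_mul]
      exact ⟨hleft, hright⟩
    | zero => simp
    | add y z _ _ hy hz =>
      rw [mul_add, add_mul]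
      exact ⟨J.add_mem hy.1 hz.1, J.add_mem hy.2 hz.2⟩
    | smul r y _ hy =>
      rw [mul_smul_comm, smul_mul_assoc]
      exact ⟨J.smul_mem r hy.1, J.smul_mem r hy.2⟩
end

section
/- Let X=(I,(·,·)) be a Cartan datum and σ an admissible automorphism of X. Then the induced pair ul X=(J,(·,·)) is again a Cartan datum, where J is the set of σ-orbits in I, α_j=Σ_{i∈j}α_i for j∈J, and (·,·) is the restriction of the form to the span of {α_j : j∈J}. Concretely: for every j∈J and any i∈j, (α_j,α_j)=|j|·(α_i,α_i) is a positive even integer, and for all j≠j' in J, 2(α_j,α_{j'})/(α_j,α_j) is a nonpositive integer. -/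
noncomputable section

/-- A Cartan datum `X = (I, (·,·))`: a finite set `I` and a symmetric bilinear form
on `⊕_{i ∈ I} ℚ α_i`, recorded by its values `pairing i j = (α_i, α_j)`, such that
`(α_i, α_i)` is a positive even integer and `2(α_i,α_j)/(α_i,α_i)` is a nonpositive
integer for `i ≠ j`. -/
structure CartanDatum (I : Type*) [Fintype I] where
  pairing : I → I → ℚ
  symm : ∀ i j, pairing i j = pairing j i
  diag_pos_even : ∀ i, ∃ d : ℤ, 0 < d ∧ pairing i i = 2 * d
  off_diag_nonpos_int : ∀ i j, i ≠ j → ∃ a : ℤ, a ≤ 0 ∧ 2 * pairing i j = a * pairing i i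

/-- `i` and `j` lie in the same `σ`-orbit. -/
def SameOrbit {I : Type*} (σ : Equiv.Perm I) (i j : I) : Prop := ∃ m : ℤ, (σ ^ m) i = j

/-- An admissible automorphism of a Cartan datum: a permutation of `I` preserving the
form, such that distinct elements of the same orbit are orthogonal. -/
structure AdmissibleAut {I : Type*} [Fintype I] (X : CartanDatum I) where
  σ : Equiv.Perm I
  invariant : ∀ i j, X.pairing (σ i) (σ j) = X.pairing i j
  orbit_orthogonal : ∀ i j, i ≠ j → SameOrbit σ i j → X.pairing i j = 0

open Classical in
/-- The `σ`-orbit of `i` as a finset. -/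
def orbitFinset {I : Type*} [Fintype I] (σ : Equiv.Perm I) (i : I) : Finset I :=
  Finset.univ.filter (fun i' => SameOrbit σ i i')

/-- The folded form `(α_j, α_{j'})` between the orbit sums `α_j = Σ_{i ∈ j} α_i`,
for the orbits `j`, `j'` of `i` and `i'`. -/
def foldedPairing {I : Type*} [Fintype I] (X : CartanDatum I) (σ : Equiv.Perm I)
    (i i' : I) : ℚ :=
  ∑ a ∈ orbitFinset σ i, ∑ b ∈ orbitFinset σ i', X.pairing a b

theorem sameOrbit_iff_sameCycle {I : Type*} (σ : Equiv.Perm I) (i j : I) :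
    SameOrbit σ i j ↔ σ.SameCycle i j :=
  Iff.rfl

theorem mem_orbitFinset {I : Type*} [Fintype I] {σ : Equiv.Perm I} {i j : I} :
    j ∈ orbitFinset σ i ↔ SameOrbit σ i j := by
  simp [orbitFinset]

theorem self_mem_orbitFinset {I : Type*} [Fintype I] (σ : Equiv.Perm I) (i : I) :
    i ∈ orbitFinset σ i :=
  mem_orbitFinset.2 (Equiv.Perm.SameCycle.refl σ i)

namespace AdmissibleAut

variable {I : Type*} [Fintype I] {X : CartanDatum I} (A : AdmissibleAut X)

/-- The sum `(α_a, α_j)` over an orbit `j` is unchanged when `a` is moved by `σ`. -/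
theorem sum_pairing_apply (a i' : I) :
    ∑ b ∈ orbitFinset A.σ i', X.pairing (A.σ a) b =
      ∑ b ∈ orbitFinset A.σ i', X.pairing a b := by
  refine (Finset.sum_equiv A.σ (fun b => ?_) fun b _ => (A.invariant a b).symm).symm
  simp [mem_orbitFinset, sameOrbit_iff_sameCycle]

theorem sum_pairing_eq_of_sameOrbit {i a : I} (h : SameOrbit A.σ i a) (i' : I) :
    ∑ b ∈ orbitFinset A.σ i', X.pairing a b = ∑ b ∈ orbitFinset A.σ i', X.pairing i b := by
  classical
  obtain ⟨n, -, -, rfl⟩ := Equiv.Perm.SameCycle.exists_pow_eq A.σ h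
  induction n with
  | zero => simp
  | succ n ih =>
    rw [pow_succ', Equiv.Perm.mul_apply, sum_pairing_apply]
    exact ih ⟨n, by simp⟩

theorem foldedPairing_eq_card_mul (i i' : I) :
    foldedPairing X A.σ i i' =
      (orbitFinset A.σ i).card * ∑ b ∈ orbitFinset A.σ i', X.pairing i b := by
  rw [foldedPairing, Finset.sum_congr rfl fun a ha =>
    A.sum_pairing_eq_of_sameOrbit (mem_orbitFinset.1 ha) i', Finset.sum_const, nsmul_eq_mul]

theorem foldedPairing_self (i : I) :
    foldedPairing X A.σ i i = (orbitFinset A.σ i).card * X.pairing i i := by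
  rw [foldedPairing_eq_card_mul, Finset.sum_eq_single_of_mem i (self_mem_orbitFinset A.σ i)]
  exact fun b hb hbi => A.orbit_orthogonal i b hbi.symm (mem_orbitFinset.1 hb)

end AdmissibleAut

theorem CartanDatum.exists_nonpos_two_mul_sum_pairing {I : Type*} [Fintype I]
    (X : CartanDatum I) {i : I} {s : Finset I} (hi : i ∉ s) :
    ∃ a : ℤ, a ≤ 0 ∧ 2 * ∑ b ∈ s, X.pairing i b = a * X.pairing i i := by
  have h : ∀ b : s, ∃ a : ℤ, a ≤ 0 ∧ 2 * X.pairing i b = a * X.pairing i i := fun b =>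
    X.off_diag_nonpos_int i b fun hib => hi (hib ▸ b.2)
  choose a ha hab using h
  refine ⟨∑ b, a b, Finset.sum_nonpos fun b _ => ha b, ?_⟩
  rw [← Finset.sum_coe_sort, Finset.mul_sum, Int.cast_sum, Finset.sum_mul]
  exact Finset.sum_congr rfl fun b _ => hab b

/-!
STATEMENT 13: if `X` is a Cartan datum and `σ` an admissible automorphism, then the
induced pair `ul X = (J, (·,·))` on the set `J` of `σ`-orbits, with `α_j = Σ_{i∈j} α_i`,
is again a Cartan datum: for every orbit `j` (of a representative `i`),
`(α_j,α_j) = |j| (α_i,α_i)` is a positive even integer, and for orbits `j ≠ j'`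
(of representatives `i, i'` in distinct orbits), `2(α_j,α_{j'})/(α_j,α_j)` is a
nonpositive integer.
-/
theorem folded_cartan_datum {I : Type*} [Fintype I] (X : CartanDatum I)
    (A : AdmissibleAut X) :
    (∀ i : I,
      foldedPairing X A.σ i i = (orbitFinset A.σ i).card * X.pairing i i ∧
      ∃ d : ℤ, 0 < d ∧ foldedPairing X A.σ i i = 2 * d) ∧
    (∀ i i' : I, ¬ SameOrbit A.σ i i' →
      ∃ a : ℤ, a ≤ 0 ∧
        2 * foldedPairing X A.σ i i' = a * foldedPairing X A.σ i i) := by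
  refine ⟨fun i => ⟨A.foldedPairing_self i, ?_⟩, fun i i' hii' => ?_⟩
  · obtain ⟨d, hd, hdi⟩ := X.diag_pos_even i
    have hcard : 0 < (orbitFinset A.σ i).card :=
      Finset.card_pos.2 ⟨i, self_mem_orbitFinset A.σ i⟩
    refine ⟨(orbitFinset A.σ i).card * d, by positivity, ?_⟩
    rw [A.foldedPairing_self, hdi]
    push_cast
    ring
  · have hi : i ∉ orbitFinset A.σ i' := fun h =>
      hii' (Equiv.Perm.SameCycle.symm (mem_orbitFinset.1 h))
    obtain ⟨a, ha, hsum⟩ := X.exists_nonpos_two_mul_sum_pairing hi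
    refine ⟨a, ha, ?_⟩
    rw [A.foldedPairing_self, A.foldedPairing_eq_card_mul, mul_left_comm, hsum, mul_left_comm]
end
end
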